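/- There is no Lagrangian embedding of the 2-sphere into ℝ⁴: there exists no smooth embedding f : S² → ℝ² × ℝ² such that for every p ∈ S² and all tangent vectors v, w ∈ T_pS², ω(d_pf(v), d_pf(w)) = 0, where ω is the standard symplectic form on ℝ⁴. -/

import Mathlib

open Metric
open scoped Manifold

/-- The standard symplectic form on `ℝ⁴ = ℝ² × ℝ²`:
`ω((x,y),(x',y')) = ⟨x,y'⟩ − ⟨y,x'⟩`. -/
def stdSymplecticForm2 (u v : (Fin 2 → ℝ) × (Fin 2 → ℝ)) : ℝ :=
  (∑ i, u.1 i * v.2 i) - ∑ i, u.2 i * v.1 i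

namespace LagSphere

open MeasureTheory Set

/-- The target space. -/
abbrev V4 := (Fin 2 → ℝ) × (Fin 2 → ℝ)

/-- The symplectic form as a bilinear map. -/
noncomputable def om : V4 →L[ℝ] V4 →L[ℝ] ℝ :=
  (LinearMap.mk₂ ℝ stdSymplecticForm2
    (by intros; simp [stdSymplecticForm2, Fin.sum_univ_two]; ring)
    (by intros; simp [stdSymplecticForm2, Fin.sum_univ_two]; ring)
    (by intros; simp [stdSymplecticForm2, Fin.sum_univ_two]; ring)
    (by intros; simp [stdSymplecticForm2, Fin.sum_univ_two]; ring)).toContinuousBilinearMap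

lemma om_apply (u v : V4) : om u v =
    u.1 0 * v.2 0 + u.1 1 * v.2 1 - (u.2 0 * v.1 0 + u.2 1 * v.1 1) := by
  change stdSymplecticForm2 u v = _
  simp [stdSymplecticForm2, Fin.sum_univ_two]

/-- The complex structure. -/
noncomputable def Jc : V4 →L[ℝ] V4 :=
  (-ContinuousLinearMap.snd ℝ (Fin 2 → ℝ) (Fin 2 → ℝ)).prod
    (ContinuousLinearMap.fst ℝ (Fin 2 → ℝ) (Fin 2 → ℝ))

@[simp] lemma Jc_fst (u : V4) : (Jc u).1 = -u.2 := rfl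
@[simp] lemma Jc_snd (u : V4) : (Jc u).2 = u.1 := rfl

/-- The Euclidean inner product. -/
noncomputable def dt : V4 →L[ℝ] V4 →L[ℝ] ℝ := om.flip.comp Jc |>.flip

lemma dt_eq (u v : V4) : dt u v = om u (Jc v) := rfl

lemma dt_apply (u v : V4) : dt u v =
    u.1 0 * v.1 0 + u.1 1 * v.1 1 + (u.2 0 * v.2 0 + u.2 1 * v.2 1) := by
  rw [dt_eq, om_apply]; simp; ring

lemma om_swap (u v : V4) : om u v = - om v u := by
  rw [om_apply, om_apply]; ring

lemma dt_comm (u v : V4) : dt u v = dt v u := by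
  rw [dt_apply, dt_apply]; ring

lemma dt_self_pos {u : V4} (hu : u ≠ 0) : 0 < dt u u := by
  rw [dt_apply]
  by_contra! h
  apply hu
  have a := mul_self_nonneg (u.1 0)
  have b := mul_self_nonneg (u.1 1)
  have c := mul_self_nonneg (u.2 0)
  have d := mul_self_nonneg (u.2 1)
  have a' : u.1 0 = 0 := mul_self_eq_zero.mp (by linarith)
  have b' : u.1 1 = 0 := mul_self_eq_zero.mp (by linarith)
  have c' : u.2 0 = 0 := mul_self_eq_zero.mp (by linarith)
  have d' : u.2 1 = 0 := mul_self_eq_zero.mp (by linarith)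
  ext i <;> fin_cases i <;> simpa

/-- The volume form, as a Pfaffian. -/
noncomputable def Pf (a b c d : V4) : ℝ := om a b * om c d - om a c * om b d + om a d * om b c

lemma Pf_perp {N a b c d : V4} (hN : dt N N = 1) (ha : dt N a = 0) (hb : dt N b = 0)
    (hc : dt N c = 0) (hd : dt N d = 0) : Pf a b c d = 0 := by
  have key : dt N N * Pf a b c d = dt N a * Pf N b c d + dt N b * Pf a N c d
      + dt N c * Pf a b N d + dt N d * Pf a b c N := by
    simp only [Pf, om_apply, dt_apply]
    ring
  rw [hN, ha, hb, hc, hd] at key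
  linarith

section calculus
variable {X : Type*} [NormedAddCommGroup X] [NormedSpace ℝ X]

lemma om_hasFDerivAt {a b : X → V4} {x : X} (ha : DifferentiableAt ℝ a x)
    (hb : DifferentiableAt ℝ b x) :
    DifferentiableAt ℝ (fun x => om (a x) (b x)) x ∧ ∀ v,
      fderiv ℝ (fun x => om (a x) (b x)) x v =
        om (fderiv ℝ a x v) (b x) + om (a x) (fderiv ℝ b x v) := by
  have := om.hasFDerivAt_of_bilinear ha.hasFDerivAt hb.hasFDerivAt
  refine ⟨this.differentiableAt, fun v => ?_⟩
  rw [this.fderiv]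
  simp [add_comm]

lemma Pf_hasFDerivAt {a b c d : X → V4} {x : X} (ha : DifferentiableAt ℝ a x)
    (hb : DifferentiableAt ℝ b x) (hc : DifferentiableAt ℝ c x) (hd : DifferentiableAt ℝ d x) :
    DifferentiableAt ℝ (fun x => Pf (a x) (b x) (c x) (d x)) x ∧ ∀ v,
      fderiv ℝ (fun x => Pf (a x) (b x) (c x) (d x)) x v =
        Pf (fderiv ℝ a x v) (b x) (c x) (d x) + Pf (a x) (fderiv ℝ b x v) (c x) (d x)
        + Pf (a x) (b x) (fderiv ℝ c x v) (d x) + Pf (a x) (b x) (c x) (fderiv ℝ d x v) := by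
  obtain ⟨ab, ab'⟩ := om_hasFDerivAt ha hb
  obtain ⟨ac, ac'⟩ := om_hasFDerivAt ha hc
  obtain ⟨ad, ad'⟩ := om_hasFDerivAt ha hd
  obtain ⟨bc, bc'⟩ := om_hasFDerivAt hb hc
  obtain ⟨bd, bd'⟩ := om_hasFDerivAt hb hd
  obtain ⟨cd, cd'⟩ := om_hasFDerivAt hc hd
  have h := ((ab.hasFDerivAt.mul cd.hasFDerivAt).sub (ac.hasFDerivAt.mul bd.hasFDerivAt)).add
    (ad.hasFDerivAt.mul bc.hasFDerivAt)
  refine ⟨h.differentiableAt, fun v => ?_⟩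
  have h2 : fderiv ℝ (fun x => Pf (a x) (b x) (c x) (d x)) x = _ := h.fderiv
  rw [h2]
  simp only [_root_.add_apply, _root_.sub_apply,
    _root_.smul_apply, smul_eq_mul, ab', ac', ad', bc', bd', cd', Pf]
  ring

end calculus

section pd
variable {n : ℕ}

/-- Partial derivative. -/
noncomputable def pd (N : (Fin n → ℝ) → V4) (j : Fin n) (x : Fin n → ℝ) : V4 :=
  fderiv ℝ N x (Pi.single j 1)

lemma pd_contDiff {N : (Fin n → ℝ) → V4} (hN : ContDiff ℝ (⊤ : ℕ∞) N) (j : Fin n) :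
    ContDiff ℝ (⊤ : ℕ∞) (pd N j) := by
  unfold pd
  exact (hN.fderiv_right (m := (⊤ : ℕ∞)) (by simp)).clm_apply contDiff_const

lemma pd_diff {N : (Fin n → ℝ) → V4} (hN : ContDiff ℝ (⊤ : ℕ∞) N) (j : Fin n) :
    Differentiable ℝ (pd N j) := (pd_contDiff hN j).differentiable (by simp)

lemma pd_symm {N : (Fin n → ℝ) → V4} (hN : ContDiff ℝ (⊤ : ℕ∞) N) (j k : Fin n) (x) :
    pd (pd N j) k x = pd (pd N k) j x := by
  have hs : IsSymmSndFDerivAt ℝ N x := hN.contDiffAt.isSymmSndFDerivAt (by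
    rw [minSmoothness_of_isRCLikeNormedField]; exact ENat.LEInfty.out)
  have hd : DifferentiableAt ℝ (fderiv ℝ N) x :=
    ((hN.fderiv_right (m := (⊤ : ℕ∞)) (by simp)).differentiable (by simp)) x
  have : ∀ v w, fderiv ℝ (fun x => fderiv ℝ N x v) x w = fderiv ℝ (fderiv ℝ N) x w v := by
    intro v w
    rw [fderiv_clm_apply hd (by simp)]
    simp
  unfold pd
  rw [this, this]
  exact hs _ _

lemma pd_perp {N : (Fin n → ℝ) → V4} (hN : ContDiff ℝ (⊤ : ℕ∞) N) (h1 : ∀ x, dt (N x) (N x) = 1)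
    (j : Fin n) (x) : dt (N x) (pd N j x) = 0 := by
  have hd : DifferentiableAt ℝ N x := (hN.differentiable (by simp)) x
  have h := dt.hasFDerivAt_of_bilinear hd.hasFDerivAt hd.hasFDerivAt
  have h2 : HasFDerivAt (fun y => dt (N y) (N y)) (0 : (Fin n → ℝ) →L[ℝ] ℝ) x := by
    simp only [h1]; exact hasFDerivAt_const _ _
  have h3 := congrArg (fun L => L (Pi.single j 1)) (h.unique h2)
  simp at h3
  rw [dt_comm (fderiv ℝ N x _)] at h3
  unfold pd
  linarith

lemma fderiv_const_line {N : (Fin n → ℝ) → V4} {x v} (hd : DifferentiableAt ℝ N x)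
    (h : ∀ r : ℝ, N (x + r • v) = N x) : fderiv ℝ N x v = 0 := by
  have := hd.hasFDerivAt.hasLineDerivAt v
  have h2 : HasLineDerivAt ℝ N 0 x v := by
    unfold HasLineDerivAt
    simp only [h]
    exact hasDerivAt_const _ _
  exact this.unique h2

lemma pd_periodic {N : (Fin n → ℝ) → V4} {c} (h : ∀ x, N (x + c) = N x) (j x) :
    pd N j (x + c) = pd N j x := by
  unfold pd
  rw [← fderiv_comp_add_right]
  simp only [h]

lemma insertNth_eq {m : ℕ} (i : Fin (m+1)) (a b : ℝ) (y : Fin m → ℝ) :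
    (Fin.insertNth i b y : Fin (m+1) → ℝ) = Fin.insertNth i a y + (b - a) • Pi.single i 1 := by
  ext k
  refine Fin.succAboveCases i ?_ (fun k => ?_) k <;> simp

end pd

lemma om_self (u : V4) : om u u = 0 := by rw [om_apply]; ring

/-- The degree integral. -/
noncomputable def deg (M : (Fin 3 → ℝ) → V4) : ℝ :=
  ∫ x in Icc (0 : Fin 3 → ℝ) ![2 * Real.pi, Real.pi, 2 * Real.pi],
    Pf (M x) (pd M 0 x) (pd M 1 x) (pd M 2 x)

lemma pd_cons {N : (Fin 4 → ℝ) → V4} (hN : Differentiable ℝ N) (s : ℝ) (j : Fin 3) (y) :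
    pd (fun y : Fin 3 → ℝ => N (Fin.cons s y)) j y = pd N j.succ (Fin.cons s y) := by
  have h : HasFDerivAt (fun y : Fin 3 → ℝ => (Fin.cons s y : Fin 4 → ℝ))
      (ContinuousLinearMap.pi (Fin.cons 0 fun i => ContinuousLinearMap.proj i) :
        (Fin 3 → ℝ) →L[ℝ] (Fin 4 → ℝ)) y := by
    rw [hasFDerivAt_pi']
    intro i
    refine Fin.cases ?_ (fun i => ?_) i
    · simpa using! hasFDerivAt_const _ _
    · simpa using! hasFDerivAt_apply i y
  have h2 := (hN (Fin.cons s y)).hasFDerivAt.comp y h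
  unfold pd
  have h3 : fderiv ℝ (fun y : Fin 3 → ℝ => N (Fin.cons s y)) y = _ := h2.fderiv
  rw [h3]
  simp only [ContinuousLinearMap.comp_apply]
  congr 1
  ext i
  refine Fin.cases ?_ (fun i => ?_) i
  · simp
  · simp [Pi.single_apply]

/-- Boundary conditions for maps of four variables. -/
structure Adm4 (N : (Fin 4 → ℝ) → V4) : Prop where
  smooth : ContDiff ℝ (⊤ : ℕ∞) N
  per1 : ∀ x, N (x + (2 * Real.pi) • Pi.single 1 1) = N x
  per3 : ∀ x, N (x + (2 * Real.pi) • Pi.single 3 1) = N x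
  bd0 : ∀ x : Fin 4 → ℝ, x 2 = 0 → ∀ r : ℝ,
    N (x + r • (Pi.single 1 1 - Pi.single 3 1 : Fin 4 → ℝ)) = N x
  bdpi : ∀ x : Fin 4 → ℝ, x 2 = Real.pi → ∀ r : ℝ,
    N (x + r • (Pi.single 1 1 + Pi.single 3 1 : Fin 4 → ℝ)) = N x

/-- The flux field. -/
noncomputable def flux (N : (Fin 4 → ℝ) → V4) (x : Fin 4 → ℝ) : Fin 4 → ℝ :=
  ![Pf (N x) (pd N 1 x) (pd N 2 x) (pd N 3 x), -Pf (N x) (pd N 0 x) (pd N 2 x) (pd N 3 x),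
    Pf (N x) (pd N 0 x) (pd N 1 x) (pd N 3 x), -Pf (N x) (pd N 0 x) (pd N 1 x) (pd N 2 x)]

theorem deg_homotopy {N : (Fin 4 → ℝ) → V4} (h : Adm4 N) (h1 : ∀ x, dt (N x) (N x) = 1)
    {s0 s1 : ℝ} (hs : s0 ≤ s1) :
    deg (fun y => N (Fin.cons s1 y)) = deg (fun y => N (Fin.cons s0 y)) := by
  have hdN : Differentiable ℝ N := h.smooth.differentiable (by simp)
  have hd := fun j => pd_diff h.smooth j
  have D := fun (j k l : Fin 4) x => Pf_hasFDerivAt (hdN x) (hd j x) (hd k x) (hd l x)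
  have hfl : ∀ x, HasFDerivAt (flux N) (ContinuousLinearMap.pi
      ![fderiv ℝ (fun x => Pf (N x) (pd N 1 x) (pd N 2 x) (pd N 3 x)) x,
        -fderiv ℝ (fun x => Pf (N x) (pd N 0 x) (pd N 2 x) (pd N 3 x)) x,
        fderiv ℝ (fun x => Pf (N x) (pd N 0 x) (pd N 1 x) (pd N 3 x)) x,
        -fderiv ℝ (fun x => Pf (N x) (pd N 0 x) (pd N 1 x) (pd N 2 x)) x]) x := by
    intro x
    rw [hasFDerivAt_pi']
    intro i
    fin_cases i
    · exact (D 1 2 3 x).1.hasFDerivAt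
    · exact (D 0 2 3 x).1.hasFDerivAt.neg
    · exact (D 0 1 3 x).1.hasFDerivAt
    · exact (D 0 1 2 x).1.hasFDerivAt.neg
  set f' : (Fin 4 → ℝ) → (Fin 4 → ℝ) →L[ℝ] (Fin 4 → ℝ) := fun x => ContinuousLinearMap.pi
      ![fderiv ℝ (fun x => Pf (N x) (pd N 1 x) (pd N 2 x) (pd N 3 x)) x,
        -fderiv ℝ (fun x => Pf (N x) (pd N 0 x) (pd N 2 x) (pd N 3 x)) x,
        fderiv ℝ (fun x => Pf (N x) (pd N 0 x) (pd N 1 x) (pd N 3 x)) x,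
        -fderiv ℝ (fun x => Pf (N x) (pd N 0 x) (pd N 1 x) (pd N 2 x)) x] with hf'
  have hdiv : ∀ x, ∑ i, f' x (Pi.single i 1) i = 0 := by
    intro x
    have hp := Pf_perp (h1 x) (pd_perp h.smooth h1 0 x) (pd_perp h.smooth h1 1 x)
      (pd_perp h.smooth h1 2 x) (pd_perp h.smooth h1 3 x)
    have e : ∀ j k, fderiv ℝ (pd N j) x (Pi.single k 1) = pd (pd N j) k x := fun _ _ => rfl
    have e' : ∀ k, fderiv ℝ N x (Pi.single k 1) = pd N k x := fun _ => rfl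
    simp only [Fin.sum_univ_four, hf', ContinuousLinearMap.coe_pi', Matrix.cons_val,
      _root_.neg_apply, (D 1 2 3 x).2, (D 0 2 3 x).2, (D 0 1 3 x).2, (D 0 1 2 x).2,
      e, e']
    rw [pd_symm h.smooth 1 0, pd_symm h.smooth 2 0, pd_symm h.smooth 3 0, pd_symm h.smooth 2 1,
      pd_symm h.smooth 3 1, pd_symm h.smooth 3 2]
    unfold Pf at hp ⊢
    rw [om_swap (pd N 1 x) (pd N 0 x), om_swap (pd N 2 x) (pd N 0 x),
      om_swap (pd N 3 x) (pd N 0 x), om_swap (pd N 2 x) (pd N 1 x),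
      om_swap (pd N 3 x) (pd N 1 x), om_swap (pd N 3 x) (pd N 2 x)]
    have sw := fun i j k => om_swap (pd N k x) (pd (pd N i) j x)
    simp only [sw]
    linear_combination 4 * hp
  have hmain := integral_divergence_of_hasFDerivAt_off_countable
    (![s0, 0, 0, 0]) (![s1, 2 * Real.pi, Real.pi, 2 * Real.pi])
    (by
      have := Real.pi_pos
      intro i; fin_cases i <;> simp [hs] <;> positivity) (flux N) f' ∅ countable_empty
    (fun x _ => (hfl x).continuousAt.continuousWithinAt) (fun x _ => hfl x)
    (by simp only [hdiv]; exact integrableOn_zero)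
  simp only [hdiv, integral_zero] at hmain
  rw [Fin.sum_univ_four] at hmain
  have p1 : ∀ x, flux N (x + (2 * Real.pi) • Pi.single 1 1) = flux N x := fun x => by
    unfold flux; simp only [pd_periodic h.per1, h.per1]
  have p3 : ∀ x, flux N (x + (2 * Real.pi) • Pi.single 3 1) = flux N x := fun x => by
    unfold flux; simp only [pd_periodic h.per3, h.per3]
  have b0 : ∀ x : Fin 4 → ℝ, x 2 = 0 → flux N x 2 = 0 := fun x hx => by
    have := fderiv_const_line (hdN x) (h.bd0 x hx)
    rw [map_sub, sub_eq_zero] at this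
    have this : pd N 1 x = pd N 3 x := this
    simp only [flux, Matrix.cons_val, this, Pf, om_self]
    ring
  have bp : ∀ x : Fin 4 → ℝ, x 2 = Real.pi → flux N x 2 = 0 := fun x hx => by
    have := fderiv_const_line (hdN x) (h.bdpi x hx)
    rw [map_add] at this
    have this : pd N 1 x = - pd N 3 x := eq_neg_of_add_eq_zero_left this
    simp only [flux, Matrix.cons_val, this, Pf, map_neg, _root_.neg_apply, om_self]
    ring
  have e1 : ∀ y, flux N (Fin.insertNth (α := fun _ => ℝ) 1 (2 * Real.pi) y) =
      flux N (Fin.insertNth (α := fun _ => ℝ) 1 0 y) := fun y => by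
    rw [insertNth_eq 1 0 (2 * Real.pi), sub_zero, p1]
  have e3 : ∀ y, flux N (Fin.insertNth (α := fun _ => ℝ) 3 (2 * Real.pi) y) =
      flux N (Fin.insertNth (α := fun _ => ℝ) 3 0 y) := fun y => by
    rw [insertNth_eq 3 0 (2 * Real.pi), sub_zero, p3]
  have e2 : ∀ y, flux N (Fin.insertNth (α := fun _ => ℝ) 2 0 y) 2 = 0 := fun y =>
    b0 _ (by simp)
  have e2' : ∀ y, flux N (Fin.insertNth (α := fun _ => ℝ) 2 Real.pi y) 2 = 0 := fun y =>
    bp _ (by simp)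
  simp only [Matrix.cons_val, e1, e2, e2', e3, sub_self, add_zero] at hmain
  have fa : (![s0, 0, 0, 0] : Fin 4 → ℝ) ∘ Fin.succAbove 0 = 0 := by
    ext i; fin_cases i <;> rfl
  have fb : (![s1, 2 * Real.pi, Real.pi, 2 * Real.pi] : Fin 4 → ℝ) ∘ Fin.succAbove 0 =
      ![2 * Real.pi, Real.pi, 2 * Real.pi] := by
    ext i; fin_cases i <;> rfl
  rw [fa, fb] at hmain
  have hd : ∀ s, deg (fun y => N (Fin.cons s y)) =
      ∫ x in Icc (0 : Fin 3 → ℝ) ![2 * Real.pi, Real.pi, 2 * Real.pi],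
        flux N (Fin.insertNth (α := fun _ => ℝ) 0 s x) 0 := by
    intro s
    unfold deg
    simp only [pd_cons hdN, Fin.insertNth_zero', flux]
    rfl
  rw [hd, hd]
  linarith

/-- Boundary conditions for maps of three variables. -/
structure BC (M : (Fin 3 → ℝ) → V4) : Prop where
  per0 : ∀ x, M (x + (2 * Real.pi) • Pi.single 0 1) = M x
  per2 : ∀ x, M (x + (2 * Real.pi) • Pi.single 2 1) = M x
  bd0 : ∀ x : Fin 3 → ℝ, x 1 = 0 → ∀ r : ℝ,
    M (x + r • (Pi.single 0 1 - Pi.single 2 1 : Fin 3 → ℝ)) = M x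
  bdpi : ∀ x : Fin 3 → ℝ, x 1 = Real.pi → ∀ r : ℝ,
    M (x + r • (Pi.single 0 1 + Pi.single 2 1 : Fin 3 → ℝ)) = M x

lemma Adm4.of_BC {N : (Fin 4 → ℝ) → V4} (hs : ContDiff ℝ (⊤ : ℕ∞) N)
    (h : ∀ s, BC (fun y => N (Fin.cons s y))) : Adm4 N := by
  have key : ∀ (x : Fin 4 → ℝ) (v : Fin 3 → ℝ) (w : Fin 4 → ℝ), w = Fin.cons 0 v →
      N (x + w) = N (Fin.cons (x 0) (Fin.tail x + v)) ∧ N x = N (Fin.cons (x 0) (Fin.tail x)) := by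
    intro x v w hw
    subst hw
    refine ⟨?_, by rw [Fin.cons_self_tail]⟩
    congr 1
    ext i
    refine Fin.cases ?_ (fun i => ?_) i <;> simp [Fin.tail]
  refine ⟨hs, ?_, ?_, ?_, ?_⟩
  · intro x
    obtain ⟨a, b⟩ := key x ((2 * Real.pi) • Pi.single 0 1) ((2 * Real.pi) • Pi.single 1 1)
      (by
        ext i; refine Fin.cases ?_ (fun i => ?_) i
        · simp
        · rw [Fin.cons_succ]; fin_cases i <;> simp)
    rw [a, b]; exact (h (x 0)).per0 _
  · intro x
    obtain ⟨a, b⟩ := key x ((2 * Real.pi) • Pi.single 2 1) ((2 * Real.pi) • Pi.single 3 1)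
      (by
        ext i; refine Fin.cases ?_ (fun i => ?_) i
        · simp
        · rw [Fin.cons_succ]; fin_cases i <;> simp)
    rw [a, b]; exact (h (x 0)).per2 _
  · intro x hx r
    obtain ⟨a, b⟩ := key x (r • (Pi.single 0 1 - Pi.single 2 1)) (r • (Pi.single 1 1 - Pi.single 3 1))
      (by
        ext i; refine Fin.cases ?_ (fun i => ?_) i
        · simp
        · rw [Fin.cons_succ]; fin_cases i <;> simp)
    rw [a, b]; exact (h (x 0)).bd0 _ hx r
  · intro x hx r
    obtain ⟨a, b⟩ := key x (r • (Pi.single 0 1 + Pi.single 2 1)) (r • (Pi.single 1 1 + Pi.single 3 1))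
      (by
        ext i; refine Fin.cases ?_ (fun i => ?_) i
        · simp
        · rw [Fin.cons_succ]; fin_cases i <;> simp)
    rw [a, b]; exact (h (x 0)).bdpi _ hx r

theorem deg_equivariant {M : (Fin 3 → ℝ) → V4} (hM : ContDiff ℝ (⊤ : ℕ∞) M) (h : BC M)
    (h1 : ∀ x, dt (M x) (M x) = 1)
    (hrot : ∀ x (r : ℝ), M (x + r • Pi.single 2 1) = Real.cos r • M x - Real.sin r • Jc (M x)) :
    deg M ≠ 0 := by
  have hdM : Differentiable ℝ M := hM.differentiable (by simp)
  have hd := fun j => pd_diff hM j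
  have hp2 : ∀ x, pd M 2 x = - Jc (M x) := by
    intro x
    have a := (hdM x).hasFDerivAt.hasLineDerivAt (Pi.single 2 1)
    have b : HasLineDerivAt ℝ M (- Jc (M x)) x (Pi.single 2 1) := by
      unfold HasLineDerivAt
      simp only [hrot]
      have := ((Real.hasDerivAt_cos 0).smul_const (M x)).sub
        ((Real.hasDerivAt_sin 0).smul_const (Jc (M x)))
      simpa using! this
    exact a.unique b
  have hJ : ∀ x, om (M x) (Jc (M x)) = 1 := h1
  have hJ' : ∀ j x, om (pd M j x) (Jc (M x)) = 0 := fun j x => by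
    rw [← dt_eq, dt_comm]; exact pd_perp hM h1 j x
  have hPf : ∀ x, Pf (M x) (pd M 0 x) (pd M 1 x) (pd M 2 x) = - om (pd M 0 x) (pd M 1 x) := by
    intro x
    simp only [Pf, hp2, map_neg, hJ, hJ']
    ring
  have D := fun (j : Fin 3) x => om_hasFDerivAt (hdM x) (hd j x)
  set fl : (Fin 3 → ℝ) → (Fin 3 → ℝ) := fun x =>
    ![om (M x) (pd M 1 x), - om (M x) (pd M 0 x), 0] with hfl
  set f' : (Fin 3 → ℝ) → (Fin 3 → ℝ) →L[ℝ] (Fin 3 → ℝ) := fun x => ContinuousLinearMap.pi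
    ![fderiv ℝ (fun x => om (M x) (pd M 1 x)) x, - fderiv ℝ (fun x => om (M x) (pd M 0 x)) x, 0]
    with hf'
  have hder : ∀ x, HasFDerivAt fl (f' x) x := by
    intro x
    rw [hasFDerivAt_pi']
    intro i
    fin_cases i
    · exact (D 1 x).1.hasFDerivAt
    · exact (D 0 x).1.hasFDerivAt.neg
    · exact hasFDerivAt_const _ _
  have hdiv : ∀ x, ∑ i, f' x (Pi.single i 1) i = 2 * om (pd M 0 x) (pd M 1 x) := by
    intro x
    have e : ∀ j k, fderiv ℝ (pd M j) x (Pi.single k 1) = pd (pd M j) k x := fun _ _ => rfl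
    have e' : ∀ k, fderiv ℝ M x (Pi.single k 1) = pd M k x := fun _ => rfl
    simp only [Fin.sum_univ_three, hf', ContinuousLinearMap.coe_pi', Matrix.cons_val,
      _root_.neg_apply, (D 0 x).2, (D 1 x).2, e, e', _root_.zero_apply]
    rw [pd_symm hM 1 0, om_swap (pd M 1 x)]
    ring
  have hcont : Continuous fun x => 2 * om (pd M 0 x) (pd M 1 x) :=
    continuous_const.mul ((om.continuous.comp (hd 0).continuous).clm_apply (hd 1).continuous)
  have hmain := integral_divergence_of_hasFDerivAt_off_countable
    (0 : Fin 3 → ℝ) (![2 * Real.pi, Real.pi, 2 * Real.pi])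
    (by
      have := Real.pi_pos
      intro i; fin_cases i <;> simp <;> positivity) fl f' ∅ countable_empty
    (fun x _ => (hder x).continuousAt.continuousWithinAt) (fun x _ => hder x)
    (by simp only [hdiv]; exact hcont.continuousOn.integrableOn_compact isCompact_Icc)
  simp only [hdiv] at hmain
  rw [Fin.sum_univ_three] at hmain
  have p0 : ∀ x, fl (x + (2 * Real.pi) • Pi.single 0 1) = fl x := fun x => by
    simp only [hfl, pd_periodic h.per0, h.per0]
  have b0 : ∀ x : Fin 3 → ℝ, x 1 = 0 → fl x 1 = 1 := fun x hx => by
    have := fderiv_const_line (hdM x) (h.bd0 x hx)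
    rw [map_sub, sub_eq_zero] at this
    have this : pd M 0 x = pd M 2 x := this
    simp only [hfl, Matrix.cons_val, this, hp2, map_neg, hJ, neg_neg]
  have bp : ∀ x : Fin 3 → ℝ, x 1 = Real.pi → fl x 1 = -1 := fun x hx => by
    have := fderiv_const_line (hdM x) (h.bdpi x hx)
    rw [map_add] at this
    have this : pd M 0 x = - pd M 2 x := eq_neg_of_add_eq_zero_left this
    simp only [hfl, Matrix.cons_val, this, hp2, hJ, neg_neg]
  have e0 : ∀ y, fl (Fin.insertNth (α := fun _ => ℝ) 0 (2 * Real.pi) y) =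
      fl (Fin.insertNth (α := fun _ => ℝ) 0 0 y) := fun y => by
    rw [insertNth_eq 0 0 (2 * Real.pi), sub_zero, p0]
  have e1 : ∀ y, fl (Fin.insertNth (α := fun _ => ℝ) 1 0 y) 1 = 1 := fun y =>
    b0 _ (by simp)
  have e1' : ∀ y, fl (Fin.insertNth (α := fun _ => ℝ) 1 Real.pi y) 1 = -1 := fun y =>
    bp _ (by simp)
  have e2 : ∀ x, fl x 2 = 0 := fun x => rfl
  simp only [Matrix.cons_val, Pi.zero_apply, e0, e1, e1', e2, sub_self, add_zero, zero_add]
    at hmain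
  have hdeg : deg M = - (1 / 2) * ∫ x in Icc (0 : Fin 3 → ℝ) ![2 * Real.pi, Real.pi, 2 * Real.pi],
      2 * om (pd M 0 x) (pd M 1 x) := by
    unfold deg
    rw [← integral_const_mul]
    congr 1
    ext x
    rw [hPf]; ring
  rw [hdeg, hmain]
  have hv : volume.real (Icc ((0 : Fin 3 → ℝ) ∘ Fin.succAbove 1)
      ((![2 * Real.pi, Real.pi, 2 * Real.pi] : Fin 3 → ℝ) ∘ Fin.succAbove 1)) =
      (2 * Real.pi) * (2 * Real.pi) := by
    have hpi := Real.pi_pos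
    rw [Measure.real, Real.volume_Icc_pi, ENNReal.toReal_prod, Fin.prod_univ_two]
    have : (Fin.succAbove (1 : Fin 3) 1) = 2 := rfl
    have h0 : (Fin.succAbove (1 : Fin 3) 0) = 0 := rfl
    simp only [Function.comp, this, h0, Matrix.cons_val, Pi.zero_apply, sub_zero]
    rw [ENNReal.toReal_ofReal (by positivity)]
  simp only [setIntegral_const, hv, smul_eq_mul]
  have hpi := Real.pi_pos
  have : 0 < 2 * Real.pi * (2 * Real.pi) := by positivity
  linarith

/-- Normalisation. -/
noncomputable def nv (u : V4) : V4 := (√(dt u u))⁻¹ • u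

lemma nv_unit {u : V4} (hu : u ≠ 0) : dt (nv u) (nv u) = 1 := by
  have := dt_self_pos hu
  simp only [nv, map_smul, _root_.smul_apply, smul_eq_mul]
  have h2 : √(dt u u) ≠ 0 := (Real.sqrt_pos.mpr this).ne'
  have h3 := Real.mul_self_sqrt this.le
  field_simp
  nlinarith

lemma nv_smooth {X : Type*} [NormedAddCommGroup X] [NormedSpace ℝ X] {H : X → V4}
    (hH : ContDiff ℝ (⊤ : ℕ∞) H) (h0 : ∀ x, H x ≠ 0) :
    ContDiff ℝ (⊤ : ℕ∞) (fun x => nv (H x)) := by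
  unfold nv
  have hq : ContDiff ℝ (⊤ : ℕ∞) fun x => dt (H x) (H x) :=
    (dt.contDiff.comp hH).clm_apply hH
  exact ((hq.sqrt (fun x => (dt_self_pos (h0 x)).ne')).inv
    (fun x => (Real.sqrt_pos.mpr (dt_self_pos (h0 x))).ne')).smul hH

lemma nv_rot (u : V4) (r : ℝ) : nv (Real.cos r • u - Real.sin r • Jc u) =
    Real.cos r • nv u - Real.sin r • Jc (nv u) := by
  have : dt (Real.cos r • u - Real.sin r • Jc u) (Real.cos r • u - Real.sin r • Jc u) = dt u u := by
    simp only [dt_apply]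
    simp
    linear_combination (u.1 0 ^ 2 + u.1 1 ^ 2 + u.2 0 ^ 2 + u.2 1 ^ 2) * Real.sin_sq_add_cos_sq r
  unfold nv
  rw [this, map_smul, smul_sub, smul_comm, smul_comm _ (Real.sin r)]

theorem deg_nv_homotopy {H : (Fin 4 → ℝ) → V4} (hH : ContDiff ℝ (⊤ : ℕ∞) H)
    (h0 : ∀ x, H x ≠ 0) (hb : ∀ s, BC (fun y => H (Fin.cons s y))) {s0 s1 : ℝ} (hs : s0 ≤ s1)
    {M0 M1 : (Fin 3 → ℝ) → V4} (e0 : ∀ y, H (Fin.cons s0 y) = M0 y)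
    (e1 : ∀ y, H (Fin.cons s1 y) = M1 y) :
    deg (fun y => nv (M1 y)) = deg (fun y => nv (M0 y)) := by
  have hA : Adm4 (fun x => nv (H x)) := Adm4.of_BC (nv_smooth hH h0) fun s =>
    ⟨fun x => congrArg nv ((hb s).per0 x), fun x => congrArg nv ((hb s).per2 x),
     fun x hx r => congrArg nv ((hb s).bd0 x hx r), fun x hx r => congrArg nv ((hb s).bdpi x hx r)⟩
  have := deg_homotopy hA (fun x => nv_unit (h0 x)) hs
  simpa only [e0, e1] using this

/-- Ambient space of the sphere. -/
abbrev E3 := EuclideanSpace ℝ (Fin 3)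

/-- Base point of the frame. -/
noncomputable def pp (y : Fin 3 → ℝ) : E3 :=
  !₂[Real.sin (y 1) * Real.cos (y 0), Real.sin (y 1) * Real.sin (y 0), Real.cos (y 1)]

/-- First tangent vector of the frame. -/
noncomputable def vv (y : Fin 3 → ℝ) : E3 :=
  !₂[Real.cos (y 2) * Real.cos (y 1) * Real.cos (y 0) - Real.sin (y 2) * Real.sin (y 0),
    Real.cos (y 2) * Real.cos (y 1) * Real.sin (y 0) + Real.sin (y 2) * Real.cos (y 0),
    - (Real.cos (y 2) * Real.sin (y 1))]

/-- Second tangent vector of the frame. -/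
noncomputable def ww (y : Fin 3 → ℝ) : E3 :=
  !₂[- (Real.sin (y 2) * Real.cos (y 1) * Real.cos (y 0)) - Real.cos (y 2) * Real.sin (y 0),
    - (Real.sin (y 2) * Real.cos (y 1) * Real.sin (y 0)) + Real.cos (y 2) * Real.cos (y 0),
    Real.sin (y 2) * Real.sin (y 1)]

lemma pp_shift (y : Fin 3 → ℝ) (r : ℝ) : pp (y + r • Pi.single 2 1) = pp y := by
  simp [pp]

lemma vv_shift (y : Fin 3 → ℝ) (r : ℝ) :
    vv (y + r • Pi.single 2 1) = Real.cos r • vv y + Real.sin r • ww y := by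
  ext i
  fin_cases i <;> simp [vv, ww, Real.cos_add, Real.sin_add] <;> ring

lemma ww_shift (y : Fin 3 → ℝ) (r : ℝ) :
    ww (y + r • Pi.single 2 1) = - Real.sin r • vv y + Real.cos r • ww y := by
  ext i
  fin_cases i <;> simp [vv, ww, Real.cos_add, Real.sin_add] <;> ring

lemma inner_three (a b : E3) : inner ℝ a b = a 0 * b 0 + a 1 * b 1 + a 2 * b 2 := by
  simp [PiLp.inner_apply, Fin.sum_univ_three]
  ring

lemma inner_pp_pp (y) : inner ℝ (pp y) (pp y) = 1 := by
  rw [inner_three]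
  simp [pp]
  have h0 := Real.sin_sq_add_cos_sq (y 0)
  have h1 := Real.sin_sq_add_cos_sq (y 1)
  linear_combination Real.sin (y 1) ^ 2 * h0 + h1

lemma inner_pp_vv (y) : inner ℝ (pp y) (vv y) = 0 := by
  simp [pp, vv, PiLp.inner_apply, Fin.sum_univ_three]
  have h0 := Real.sin_sq_add_cos_sq (y 0)
  linear_combination Real.sin (y 1) * Real.cos (y 1) * Real.cos (y 2) * h0

lemma inner_vv_vv (y) : inner ℝ (vv y) (vv y) = 1 := by
  rw [inner_three]
  simp [vv]
  have h0 := Real.sin_sq_add_cos_sq (y 0)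
  have h1 := Real.sin_sq_add_cos_sq (y 1)
  have h2 := Real.sin_sq_add_cos_sq (y 2)
  linear_combination (Real.cos (y 2) ^ 2 * Real.cos (y 1) ^ 2 + Real.sin (y 2) ^ 2) * h0 +
    Real.cos (y 2) ^ 2 * h1 + h2

lemma ww_eq (y : Fin 3 → ℝ) : ww y = vv (y + (Real.pi / 2) • Pi.single 2 1) := by
  rw [vv_shift]; simp

lemma inner_circle {q u : E3} (hq : inner ℝ q q = (1 : ℝ)) (hu : inner ℝ u u = (1 : ℝ))
    (hqu : inner ℝ q u = (0 : ℝ)) (t : ℝ) : ‖Real.cos t • q + Real.sin t • u‖ = 1 := by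
  have : ‖Real.cos t • q + Real.sin t • u‖ ^ 2 = 1 := by
    rw [← real_inner_self_eq_norm_sq]
    simp only [inner_add_left, inner_add_right, real_inner_smul_left, real_inner_smul_right, hq, hu,
      hqu, real_inner_comm q u]
    linear_combination Real.sin_sq_add_cos_sq t
  nlinarith [norm_nonneg (Real.cos t • q + Real.sin t • u)]

/-- Two parameters with the same frame. -/
def Same (y y' : Fin 3 → ℝ) : Prop := pp y = pp y' ∧ vv y = vv y' ∧ ww y = ww y'

lemma Same.shift {y y'} (h : Same y y') (r : ℝ) :
    Same (y + r • Pi.single 2 1) (y' + r • Pi.single 2 1) := by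
  obtain ⟨a, b, c⟩ := h
  refine ⟨?_, ?_, ?_⟩
  · rw [pp_shift, pp_shift, a]
  · rw [vv_shift, vv_shift, b, c]
  · rw [ww_shift, ww_shift, b, c]

lemma BC.of_same {M : (Fin 3 → ℝ) → V4} (h : ∀ y y', Same y y' → M y = M y') : BC M := by
  refine ⟨fun x => h _ _ ?_, fun x => h _ _ ?_, fun x hx r => h _ _ ?_, fun x hx r => h _ _ ?_⟩
  · simp [Same, pp, vv, ww]
  · simp [Same, pp, vv, ww]
  · refine ⟨?_, ?_, ?_⟩ <;> ext i <;> fin_cases i <;>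
      simp [pp, vv, ww, hx, Real.cos_add, Real.sin_add] <;>
      first
      | linear_combination (Real.cos (x 0) * Real.cos (x 2) - Real.sin (x 0) * Real.sin (x 2)) *
          Real.sin_sq_add_cos_sq r
      | linear_combination (Real.cos (x 0) * Real.sin (x 2) + Real.sin (x 0) * Real.cos (x 2)) *
          Real.sin_sq_add_cos_sq r
      | linear_combination - (Real.cos (x 0) * Real.sin (x 2) + Real.sin (x 0) * Real.cos (x 2)) *
          Real.sin_sq_add_cos_sq r
  · refine ⟨?_, ?_, ?_⟩ <;> ext i <;> fin_cases i <;>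
      simp [pp, vv, ww, hx, Real.cos_add, Real.sin_add] <;>
      first
      | linear_combination -(Real.cos (x 0) * Real.cos (x 2) + Real.sin (x 0) * Real.sin (x 2)) *
          Real.sin_sq_add_cos_sq r
      | linear_combination (Real.cos (x 0) * Real.cos (x 2) + Real.sin (x 0) * Real.sin (x 2)) *
          Real.sin_sq_add_cos_sq r
      | linear_combination (Real.cos (x 0) * Real.sin (x 2) - Real.sin (x 0) * Real.cos (x 2)) *
          Real.sin_sq_add_cos_sq r

lemma exists_same_mem (y : Fin 3 → ℝ) :
    ∃ y' ∈ Icc (0 : Fin 3 → ℝ) (fun _ => 2 * Real.pi), Same y y' := by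
  have key : ∀ a : ℝ, ∃ b ∈ Ico (0 : ℝ) (2 * Real.pi), Real.cos a = Real.cos b ∧
      Real.sin a = Real.sin b := by
    intro a
    have hp : Function.Periodic (fun x : ℝ => (Real.cos x, Real.sin x)) (2 * Real.pi) := by
      intro x; simp
    obtain ⟨b, hb, h⟩ := hp.exists_mem_Ico₀ Real.two_pi_pos a
    simp only [Prod.mk.injEq] at h
    exact ⟨b, hb, h⟩
  choose b hb hc hs using key
  refine ⟨fun i => b (y i), ⟨fun i => (hb _).1, fun i => (hb _).2.le⟩, ?_⟩
  simp only [Same, pp, vv, ww, ← hc, ← hs, and_self]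

/-- Unit sphere. -/
abbrev S2 := sphere (0 : E3) 1

lemma fact_finrank : Fact (Module.finrank ℝ E3 = 2 + 1) :=
  ⟨finrank_euclideanSpace_fin⟩

lemma codRestrict_smooth {X : Type*} [NormedAddCommGroup X] [NormedSpace ℝ X] {Γ : X → E3}
    (hΓ : ContDiff ℝ (⊤ : ℕ∞) Γ) (hm : ∀ x, Γ x ∈ sphere (0 : E3) 1) :
    ContMDiff 𝓘(ℝ, X) (𝓡 2) (⊤ : ℕ∞) (Set.codRestrict Γ _ hm : X → S2) := by
  haveI := fact_finrank
  exact hΓ.contMDiff.codRestrict_sphere hm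

lemma coe_smooth : ContMDiff (𝓡 2) 𝓘(ℝ, E3) (⊤ : ℕ∞) ((↑) : S2 → E3) := by
  have := @contMDiff_coe_sphere E3 _ _ (⊤ : ℕ∞) 2 fact_finrank
  exact this

lemma coe_inj (q : S2) :
    Function.Injective (mfderiv (𝓡 2) 𝓘(ℝ, E3) ((↑) : S2 → E3) q) := by
  have := @mfderiv_coe_sphere_injective E3 _ _ 2 fact_finrank q
  exact this

open Classical in
/-- Extension of a function on the sphere by zero. -/
noncomputable def ext0 (f : S2 → V4) (x : E3) : V4 :=
  if h : x ∈ sphere (0 : E3) 1 then f ⟨x, h⟩ else 0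

lemma ext0_smooth {f : S2 → V4} (hf : ContMDiff (𝓡 2) 𝓘(ℝ, V4) (⊤ : ℕ∞) f)
    {X : Type*} [NormedAddCommGroup X] [NormedSpace ℝ X] {Γ : X → E3}
    (hΓ : ContDiff ℝ (⊤ : ℕ∞) Γ) (h1 : ∀ x, ‖Γ x‖ = 1) :
    ContDiff ℝ (⊤ : ℕ∞) (fun x => ext0 f (Γ x)) := by
  have hm : ∀ x, Γ x ∈ sphere (0 : E3) 1 := fun x => by simpa using h1 x
  have h2 : ContMDiff 𝓘(ℝ, X) (𝓡 2) (⊤ : ℕ∞) (Set.codRestrict Γ _ hm : X → S2) :=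
    codRestrict_smooth hΓ hm
  have h3 := (hf.comp h2).contDiff
  convert h3 using 1
  ext x : 1
  simp only [ext0, dif_pos (hm x)]
  rfl

lemma ext0_deriv {f : S2 → V4} (hf : ContMDiff (𝓡 2) 𝓘(ℝ, V4) (⊤ : ℕ∞) f)
    (q : S2) {u : E3} (hu : inner ℝ u u = (1 : ℝ)) (hqu : inner ℝ (q : E3) u = (0 : ℝ)) :
    ∃ τ : TangentSpace (𝓡 2) q,
      mfderiv (𝓡 2) 𝓘(ℝ, E3) ((↑) : S2 → E3) q τ = u ∧
      deriv (fun t : ℝ => ext0 f (Real.cos t • (q : E3) + Real.sin t • u)) 0 =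
        mfderiv (𝓡 2) 𝓘(ℝ, V4) f q τ := by
  have hq : inner ℝ (q : E3) (q : E3) = (1 : ℝ) := by
    rw [real_inner_self_eq_norm_sq]; simp
  set Γ : ℝ → E3 := fun t => Real.cos t • (q : E3) + Real.sin t • u with hΓdef
  have hΓ : ContDiff ℝ (⊤ : ℕ∞) Γ :=
    (Real.contDiff_cos.smul contDiff_const).add (Real.contDiff_sin.smul contDiff_const)
  have hm : ∀ x, Γ x ∈ sphere (0 : E3) 1 := fun x => by simpa using inner_circle hq hu hqu x
  have h2 : ContMDiff 𝓘(ℝ, ℝ) (𝓡 2) (⊤ : ℕ∞) (Set.codRestrict Γ _ hm : ℝ → S2) :=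
    codRestrict_smooth hΓ hm
  have hΓ' : deriv Γ 0 = u := by
    have h : HasDerivAt Γ _ 0 := ((Real.hasDerivAt_cos 0).smul_const (q : E3)).add
        ((Real.hasDerivAt_sin 0).smul_const u)
    rw [h.deriv]
    simp
  have hfe : (fun t => ext0 f (Γ t)) = f ∘ (Set.codRestrict Γ _ hm : ℝ → S2) := by
    ext x : 1
    simp only [ext0, dif_pos (hm x)]
    rfl
  have hce : Γ = ((↑) : S2 → E3) ∘ (Set.codRestrict Γ _ hm : ℝ → S2) := rfl
  have hc0 : (Set.codRestrict Γ _ hm : ℝ → S2) 0 = q := by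
    ext1; simp [hΓdef]
  rw [hfe]
  rw [hce] at hΓ'
  clear hfe hce
  generalize (Set.codRestrict Γ _ hm : ℝ → S2) = c at *
  subst hc0
  have hcd : MDifferentiableAt 𝓘(ℝ, ℝ) (𝓡 2) c 0 := h2.mdifferentiableAt (by simp)
  have hfd : MDifferentiableAt (𝓡 2) 𝓘(ℝ, V4) f (c 0) := hf.mdifferentiableAt (by simp)
  have hid : MDifferentiableAt (𝓡 2) 𝓘(ℝ, E3) ((↑) : S2 → E3) (c 0) :=
    coe_smooth.mdifferentiableAt (by simp)
  refine ⟨mfderiv 𝓘(ℝ, ℝ) (𝓡 2) c 0 (1 : ℝ), ?_, ?_⟩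
  · rw [← hΓ', ← fderiv_apply_one_eq_deriv, ← mfderiv_eq_fderiv, mfderiv_comp _ hid hcd]
    rfl
  · rw [← fderiv_apply_one_eq_deriv, ← mfderiv_eq_fderiv, mfderiv_comp _ hfd hcd]
    rfl

/-- The total parametrisation. -/
noncomputable def Gm (f : S2 → V4) (x : Fin 4 → ℝ) : V4 :=
  ext0 f (Real.cos (x 0) • pp (Fin.tail x) + Real.sin (x 0) • vv (Fin.tail x))

lemma tail_contDiff : ContDiff ℝ (⊤ : ℕ∞) (fun x : Fin 4 → ℝ => (Fin.tail x : Fin 3 → ℝ)) := by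
  rw [contDiff_pi]
  intro i
  exact contDiff_apply ℝ ℝ i.succ

lemma cons_contDiff : ContDiff ℝ (⊤ : ℕ∞)
    (fun z : ℝ × (Fin 3 → ℝ) => (Fin.cons z.1 z.2 : Fin 4 → ℝ)) := by
  rw [contDiff_pi]
  intro i
  refine Fin.cases ?_ (fun i => ?_) i
  · simpa using! contDiff_fst
  · have : ContDiff ℝ (⊤ : ℕ∞) (fun z : ℝ × (Fin 3 → ℝ) => z.2 i) :=
      (contDiff_apply ℝ ℝ i).comp contDiff_snd
    simpa using! this

lemma pp_contDiff : ContDiff ℝ (⊤ : ℕ∞) pp := by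
  rw [contDiff_piLp]
  have h := fun i : Fin 3 => contDiff_apply (n := (⊤ : ℕ∞)) ℝ ℝ i
  intro i
  fin_cases i <;> simp [pp] <;> fun_prop

lemma vv_contDiff : ContDiff ℝ (⊤ : ℕ∞) vv := by
  rw [contDiff_piLp]
  intro i
  fin_cases i <;> simp [vv] <;> fun_prop

lemma norm_Gm (x : Fin 4 → ℝ) :
    ‖Real.cos (x 0) • pp (Fin.tail x) + Real.sin (x 0) • vv (Fin.tail x)‖ = 1 :=
  inner_circle (inner_pp_pp _) (inner_vv_vv _) (inner_pp_vv _) _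

lemma Gm_smooth {f : S2 → V4} (hf : ContMDiff (𝓡 2) 𝓘(ℝ, V4) (⊤ : ℕ∞) f) :
    ContDiff ℝ (⊤ : ℕ∞) (Gm f) := by
  refine ext0_smooth hf ?_ norm_Gm
  have h0 : ContDiff ℝ (⊤ : ℕ∞) fun x : Fin 4 → ℝ => x 0 := contDiff_apply ℝ ℝ 0
  exact (h0.cos.smul (pp_contDiff.comp tail_contDiff)).add
    (h0.sin.smul (vv_contDiff.comp tail_contDiff))

lemma Gm_cons (f : S2 → V4) (t : ℝ) (y : Fin 3 → ℝ) :
    Gm f (Fin.cons t y) = ext0 f (Real.cos t • pp y + Real.sin t • vv y) := by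
  simp [Gm]

lemma Gm_same (f : S2 → V4) (t : ℝ) {y y' : Fin 3 → ℝ} (h : Same y y') :
    Gm f (Fin.cons t y) = Gm f (Fin.cons t y') := by
  rw [Gm_cons, Gm_cons, h.1, h.2.1]

/-- The derivative in the direction of the first frame vector. -/
noncomputable def Am (f : S2 → V4) (y : Fin 3 → ℝ) : V4 := pd (Gm f) 0 (Fin.cons 0 y)

lemma Gm_hasDerivAt {f : S2 → V4} (hf : ContMDiff (𝓡 2) 𝓘(ℝ, V4) (⊤ : ℕ∞) f) (y) (t : ℝ) :
    HasDerivAt (fun t => Gm f (Fin.cons t y)) (pd (Gm f) 0 (Fin.cons t y)) t := by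
  have h1 : HasDerivAt (fun t : ℝ => (Fin.cons t y : Fin 4 → ℝ)) (Pi.single 0 1) t := by
    rw [hasDerivAt_pi]
    intro i
    refine Fin.cases ?_ (fun i => ?_) i
    · simpa using! hasDerivAt_id t
    · simpa using! hasDerivAt_const t (y i)
  exact (((Gm_smooth hf).differentiable (by simp)) _).hasFDerivAt.comp_hasDerivAt t h1

lemma Am_eq {f : S2 → V4} (hf : ContMDiff (𝓡 2) 𝓘(ℝ, V4) (⊤ : ℕ∞) f) (y) :
    Am f y = deriv (fun t => ext0 f (Real.cos t • pp y + Real.sin t • vv y)) 0 := by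
  rw [Am, ← (Gm_hasDerivAt hf y 0).deriv]
  simp only [Gm_cons]

lemma Am_same {f : S2 → V4} (hf : ContMDiff (𝓡 2) 𝓘(ℝ, V4) (⊤ : ℕ∞) f) {y y' : Fin 3 → ℝ}
    (h : Same y y') : Am f y = Am f y' := by
  rw [Am_eq hf, Am_eq hf, h.1, h.2.1]

/-- The base point on the sphere. -/
noncomputable def qq (y : Fin 3 → ℝ) : S2 := ⟨pp y, by
  have := inner_pp_pp y
  rw [real_inner_self_eq_norm_sq] at this
  have h2 := norm_nonneg (pp y)
  simp only [mem_sphere_iff_norm, sub_zero]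
  nlinarith⟩

lemma Am_mfderiv {f : S2 → V4} (hf : ContMDiff (𝓡 2) 𝓘(ℝ, V4) (⊤ : ℕ∞) f) (y) (r : ℝ) :
    ∃ τ : TangentSpace (𝓡 2) (qq y),
      mfderiv (𝓡 2) 𝓘(ℝ, E3) ((↑) : S2 → E3) (qq y) τ = Real.cos r • vv y + Real.sin r • ww y ∧
      Am f (y + r • Pi.single 2 1) = mfderiv (𝓡 2) 𝓘(ℝ, V4) f (qq y) τ := by
  have h := ext0_deriv hf (qq y) (u := vv (y + r • Pi.single 2 1)) (inner_vv_vv _) (by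
    have := inner_pp_vv (y + r • Pi.single 2 1)
    rwa [pp_shift] at this)
  rw [Am_eq hf, pp_shift, ← vv_shift]
  exact h

lemma Am_shift {f : S2 → V4} (hf : ContMDiff (𝓡 2) 𝓘(ℝ, V4) (⊤ : ℕ∞) f) (y) (r : ℝ) :
    Am f (y + r • Pi.single 2 1) =
      Real.cos r • Am f y + Real.sin r • Am f (y + (Real.pi / 2) • Pi.single 2 1) := by
  obtain ⟨τ0, a0, b0⟩ := Am_mfderiv hf y 0
  obtain ⟨τ1, a1, b1⟩ := Am_mfderiv hf y (Real.pi / 2)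
  obtain ⟨τ, a, b⟩ := Am_mfderiv hf y r
  have hτ : τ = Real.cos r • τ0 + Real.sin r • τ1 := by
    apply coe_inj (qq y)
    rw [map_add, map_smul, map_smul, a, a0, a1]
    simp
    rfl
  have b0' : Am f y = mfderiv (𝓡 2) 𝓘(ℝ, V4) f (qq y) τ0 := by simpa using b0
  rw [b, hτ, map_add, map_smul, map_smul, ← b0', ← b1]
  rfl

lemma Am_smooth {f : S2 → V4} (hf : ContMDiff (𝓡 2) 𝓘(ℝ, V4) (⊤ : ℕ∞) f) :
    ContDiff ℝ (⊤ : ℕ∞) (Am f) :=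
  (pd_contDiff (Gm_smooth hf) 0).comp (cons_contDiff.comp (contDiff_const.prodMk contDiff_id))

lemma Am_ne {f : S2 → V4} (hf : ContMDiff (𝓡 2) 𝓘(ℝ, V4) (⊤ : ℕ∞) f)
    (hi : ∀ p : S2, Function.Injective (mfderiv (𝓡 2) 𝓘(ℝ, V4) f p)) (y) : Am f y ≠ 0 := by
  obtain ⟨τ, a, b⟩ := Am_mfderiv hf y 0
  intro h
  have b' : Am f y = mfderiv (𝓡 2) 𝓘(ℝ, V4) f (qq y) τ := by simpa using b
  have hτ : τ = 0 := by
    apply hi (qq y)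
    rw [← b', h, map_zero]
    rfl
  have hv : vv y = 0 := by
    have : Real.cos 0 • vv y + Real.sin 0 • ww y = 0 := by
      rw [← a, hτ, map_zero]
      rfl
    simpa using this
  have := inner_vv_vv y
  rw [hv] at this
  simp at this

/-- The second frame derivative. -/
noncomputable def Bm (f : S2 → V4) (y : Fin 3 → ℝ) : V4 :=
  Am f (y + (Real.pi / 2) • Pi.single 2 1)

lemma om_Am_Bm {f : S2 → V4} (hf : ContMDiff (𝓡 2) 𝓘(ℝ, V4) (⊤ : ℕ∞) f)
    (hl : ∀ p : S2, ∀ v w : TangentSpace (𝓡 2) p,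
          stdSymplecticForm2 (mfderiv (𝓡 2) 𝓘(ℝ, V4) f p v)
            (mfderiv (𝓡 2) 𝓘(ℝ, V4) f p w) = 0) (y) : om (Am f y) (Bm f y) = 0 := by
  obtain ⟨τ, a, b⟩ := Am_mfderiv hf y 0
  obtain ⟨τ', a', b'⟩ := Am_mfderiv hf y (Real.pi / 2)
  have b0 : Am f y = mfderiv (𝓡 2) 𝓘(ℝ, V4) f (qq y) τ := by simpa using b
  rw [Bm, b0, b']
  exact hl _ _ _

lemma Bm_smooth {f : S2 → V4} (hf : ContMDiff (𝓡 2) 𝓘(ℝ, V4) (⊤ : ℕ∞) f) :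
    ContDiff ℝ (⊤ : ℕ∞) (Bm f) :=
  (Am_smooth hf).comp (contDiff_id.add contDiff_const)

lemma Jc_Jc (u : V4) : Jc (Jc u) = -u := by
  ext i <;> simp

lemma homA_ne {A B : V4} (hA : A ≠ 0) (h : om A B = 0) (s : ℝ) : A + s • Jc B ≠ 0 := by
  intro h0
  have h1 : dt A (A + s • Jc B) = 0 := by rw [h0, map_zero]
  rw [map_add, map_smul, dt_eq A (Jc B), Jc_Jc, map_neg, h] at h1
  have := dt_self_pos hA
  simp at h1
  linarith

theorem deg_A_ne {f : S2 → V4} (hf : ContMDiff (𝓡 2) 𝓘(ℝ, V4) (⊤ : ℕ∞) f)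
    (hi : ∀ p : S2, Function.Injective (mfderiv (𝓡 2) 𝓘(ℝ, V4) f p))
    (hl : ∀ p : S2, ∀ v w : TangentSpace (𝓡 2) p,
          stdSymplecticForm2 (mfderiv (𝓡 2) 𝓘(ℝ, V4) f p v)
            (mfderiv (𝓡 2) 𝓘(ℝ, V4) f p w) = 0) :
    deg (fun y => nv (Am f y)) ≠ 0 := by
  have hne : ∀ y (s : ℝ), Am f y + s • Jc (Bm f y) ≠ 0 := fun y s =>
    homA_ne (Am_ne hf hi y) (om_Am_Bm hf hl y) s
  have hsame : ∀ (s : ℝ) (y y' : Fin 3 → ℝ), Same y y' →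
      Am f y + s • Jc (Bm f y) = Am f y' + s • Jc (Bm f y') := by
    intro s y y' h
    rw [Am_same hf h, Bm, Am_same hf (h.shift _), ← Bm]
  have hx0 : ContDiff ℝ (⊤ : ℕ∞) fun x : Fin 4 → ℝ => x 0 := contDiff_apply ℝ ℝ 0
  have hhom := deg_nv_homotopy
    (H := fun x => Am f (Fin.tail x) + x 0 • Jc (Bm f (Fin.tail x)))
    (M0 := fun y => Am f y) (M1 := fun y => Am f y + (1 : ℝ) • Jc (Bm f y)) (s0 := 0) (s1 := 1)
    (((Am_smooth hf).comp tail_contDiff).add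
      (hx0.smul (Jc.contDiff.comp ((Bm_smooth hf).comp tail_contDiff))))
    (fun x => hne _ _) (fun s => BC.of_same fun y y' h => by simpa using! hsame s y y' h)
    zero_le_one (fun y => by simp) (fun y => by simp)
  rw [← hhom]
  have hU : ContDiff ℝ (⊤ : ℕ∞) fun y => Am f y + (1 : ℝ) • Jc (Bm f y) :=
    (Am_smooth hf).add ((Jc.contDiff.comp (Bm_smooth hf)).const_smul (1 : ℝ))
  refine deg_equivariant (nv_smooth hU fun y => hne y 1)
    (BC.of_same fun y y' h => by rw [hsame 1 y y' h]) (fun y => nv_unit (hne y 1)) ?_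
  intro y r
  rw [← nv_rot]
  congr 1
  have hB : Bm f (y + r • Pi.single 2 1) = - Real.sin r • Am f y + Real.cos r • Bm f y := by
    rw [Bm, add_assoc, ← add_smul, Am_shift hf y (r + Real.pi / 2), Real.cos_add_pi_div_two,
      Real.sin_add_pi_div_two, ← Bm]
  rw [hB, Am_shift hf y r, ← Bm]
  simp only [map_add, map_smul, map_neg, one_smul, neg_smul, Jc_Jc]
  module

lemma exists_eps {f : S2 → V4} (hf : ContMDiff (𝓡 2) 𝓘(ℝ, V4) (⊤ : ℕ∞) f)
    (hi : ∀ p : S2, Function.Injective (mfderiv (𝓡 2) 𝓘(ℝ, V4) f p)) :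
    ∃ ε : ℝ, 0 < ε ∧ ε < Real.pi ∧ ∀ y,
      ‖ε⁻¹ • (Gm f (Fin.cons ε y) - Gm f (Fin.cons 0 y)) - Am f y‖ < ‖Am f y‖ := by
  have hc : Continuous fun z : ℝ × (Fin 3 → ℝ) => ‖pd (Gm f) 0 (Fin.cons z.1 z.2) - Am f z.2‖ :=
    ((((pd_contDiff (Gm_smooth hf) 0).comp cons_contDiff).continuous).sub
      ((Am_smooth hf).continuous.comp continuous_snd)).norm
  have hc2 : Continuous fun z : ℝ × (Fin 3 → ℝ) => ‖Am f z.2‖ / 2 :=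
    (((Am_smooth hf).continuous.comp continuous_snd).norm).div_const 2
  obtain ⟨u, v, hu, hv, h0u, hKv, huv⟩ := generalized_tube_lemma
    (isCompact_singleton (x := (0 : ℝ)))
    (isCompact_Icc (a := (0 : Fin 3 → ℝ)) (b := fun _ => 2 * Real.pi))
    (isOpen_lt hc hc2) (by
      rintro ⟨t, y⟩ ⟨ht, -⟩
      obtain rfl : t = 0 := ht
      have := norm_pos_iff.2 (Am_ne hf hi y)
      simp only [mem_setOf_eq]
      rw [← Am, sub_self, norm_zero]
      positivity)
  obtain ⟨δ, hδ, hball⟩ := Metric.isOpen_iff.1 hu 0 (h0u rfl)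
  refine ⟨min (δ / 2) 1, by positivity, ?_, ?_⟩
  · have := Real.pi_gt_three
    have := min_le_right (δ / 2) 1
    linarith
  set ε := min (δ / 2) 1 with hε
  have hε0 : 0 < ε := by positivity
  have hεδ : ε < δ := by
    have := min_le_left (δ / 2) 1
    linarith
  clear_value ε
  intro y
  obtain ⟨y', hy', hs⟩ := exists_same_mem y
  rw [Gm_same f _ hs, Gm_same f _ hs, Am_same hf hs]
  have hpos := norm_pos_iff.2 (Am_ne hf hi y')
  have hmv := (convex_Icc (0 : ℝ) ε).norm_image_sub_le_of_norm_hasDerivWithin_le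
    (f := fun t => Gm f (Fin.cons t y') - t • Am f y')
    (f' := fun t => pd (Gm f) 0 (Fin.cons t y') - (1 : ℝ) • Am f y') (C := ‖Am f y'‖ / 2)
    (fun t ht => ((Gm_hasDerivAt hf y' t).sub
      ((hasDerivAt_id t).smul_const (Am f y'))).hasDerivWithinAt)
    (fun t ht => by
      have hm : (t, y') ∈ u ×ˢ v := ⟨hball (by
        rw [Metric.mem_ball, Real.dist_eq, sub_zero, abs_of_nonneg ht.1]
        linarith [ht.2]), hKv hy'⟩
      have := huv hm
      simp only [mem_setOf_eq] at this
      rw [one_smul]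
      exact this.le)
    (left_mem_Icc.2 hε0.le) (right_mem_Icc.2 hε0.le)
  simp only [zero_smul, sub_zero, Real.norm_eq_abs, abs_of_pos hε0] at hmv
  have he : ε⁻¹ • (Gm f (Fin.cons ε y') - Gm f (Fin.cons 0 y')) - Am f y' =
      ε⁻¹ • (Gm f (Fin.cons ε y') - ε • Am f y' - Gm f (Fin.cons 0 y')) := by
    rw [sub_right_comm (Gm f (Fin.cons ε y')) (ε • Am f y'), smul_sub ε⁻¹ _ (ε • Am f y'), smul_smul,
      inv_mul_cancel₀ hε0.ne', one_smul]
  rw [he, norm_smul, norm_inv, Real.norm_eq_abs, abs_of_pos hε0, inv_mul_lt_iff₀ hε0]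
  nlinarith

lemma homB_ne {a d : V4} (h : ‖d‖ < ‖a‖) (s : ℝ) : a + (Real.sin s) ^ 2 • d ≠ 0 := by
  intro h0
  have h1 : a = -((Real.sin s) ^ 2 • d) := eq_neg_of_add_eq_zero_left h0
  have h2 : ‖a‖ = Real.sin s ^ 2 * ‖d‖ := by
    conv_lhs => rw [h1]
    rw [norm_neg, norm_smul, Real.norm_eq_abs, abs_of_nonneg (sq_nonneg _)]
  have h3 := Real.sin_sq_le_one s
  nlinarith [norm_nonneg d]

lemma Gm_ne {f : S2 → V4} (hinj : Function.Injective f) {t : ℝ} (h0 : 0 < t) (h1 : t ≤ Real.pi)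
    (y) : Gm f (Fin.cons t y) - Gm f (Fin.cons 0 y) ≠ 0 := by
  intro h
  have h := sub_eq_zero.1 h
  have hn := fun t : ℝ => norm_Gm (Fin.cons t y)
  simp only [Fin.cons_zero, Fin.tail_cons] at hn
  have hm : ∀ t : ℝ, Real.cos t • pp y + Real.sin t • vv y ∈ sphere (0 : E3) 1 := fun t => by
    simpa using hn t
  rw [Gm_cons, Gm_cons, ext0, ext0, dif_pos (hm _), dif_pos (hm _)] at h
  have h2 := congrArg Subtype.val (hinj h)
  have h3 := congrArg (fun z => inner ℝ (pp y) z) h2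
  simp only [inner_add_right, real_inner_smul_right, inner_pp_pp, inner_pp_vv, mul_one, mul_zero,
    add_zero, Real.cos_zero] at h3
  have := Real.cos_lt_cos_of_nonneg_of_le_pi le_rfl h1 h0
  rw [Real.cos_zero, h3] at this
  exact lt_irrefl _ this

theorem deg_A_eq {f : S2 → V4} (hf : ContMDiff (𝓡 2) 𝓘(ℝ, V4) (⊤ : ℕ∞) f)
    (hinj : Function.Injective f)
    (hi : ∀ p : S2, Function.Injective (mfderiv (𝓡 2) 𝓘(ℝ, V4) f p)) :
    deg (fun y => nv (Am f y)) = 0 := by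
  obtain ⟨ε, he0, he1, he⟩ := exists_eps hf hi
  have hx0 : ContDiff ℝ (⊤ : ℕ∞) fun x : Fin 4 → ℝ => x 0 := contDiff_apply ℝ ℝ 0
  have hpi : (0 : ℝ) ≤ Real.pi / 2 := by positivity
  have hGc : ∀ {τ : (Fin 4 → ℝ) → ℝ}, ContDiff ℝ (⊤ : ℕ∞) τ →
      ContDiff ℝ (⊤ : ℕ∞) fun x : Fin 4 → ℝ => Gm f (Fin.cons (τ x) (Fin.tail x)) := fun hτ =>
    (Gm_smooth hf).comp (cons_contDiff.comp (hτ.prodMk tail_contDiff))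
  have hB := deg_nv_homotopy
    (H := fun x => Am f (Fin.tail x) + (Real.sin (x 0)) ^ 2 •
      (ε⁻¹ • (Gm f (Fin.cons ε (Fin.tail x)) - Gm f (Fin.cons 0 (Fin.tail x)))
        - Am f (Fin.tail x)))
    (M0 := fun y => Am f y)
    (M1 := fun y => ε⁻¹ • (Gm f (Fin.cons ε y) - Gm f (Fin.cons 0 y)))
    (s0 := 0) (s1 := Real.pi / 2)
    (((Am_smooth hf).comp tail_contDiff).add ((hx0.sin.pow 2).smul
      (((((hGc contDiff_const).sub (hGc contDiff_const))).const_smul ε⁻¹).sub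
        ((Am_smooth hf).comp tail_contDiff))))
    (fun x => homB_ne (he _) _)
    (fun s => BC.of_same fun y y' h => by
      simp only [Fin.cons_zero, Fin.tail_cons]
      rw [Am_same hf h, Gm_same f _ h, Gm_same f _ h])
    hpi (fun y => by simp) (fun y => by simp)
  have hC := deg_nv_homotopy
    (H := fun x => ε⁻¹ • (Gm f (Fin.cons (ε + (Real.pi - ε) * (Real.sin (x 0)) ^ 2) (Fin.tail x))
      - Gm f (Fin.cons 0 (Fin.tail x))))
    (M0 := fun y => ε⁻¹ • (Gm f (Fin.cons ε y) - Gm f (Fin.cons 0 y)))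
    (M1 := fun y => ε⁻¹ • (Gm f (Fin.cons Real.pi y) - Gm f (Fin.cons 0 y)))
    (s0 := 0) (s1 := Real.pi / 2)
    (((hGc (contDiff_const.add (contDiff_const.mul (hx0.sin.pow 2)))).sub
      (hGc contDiff_const)).const_smul ε⁻¹)
    (fun x => smul_ne_zero (inv_ne_zero he0.ne') (Gm_ne hinj
      (by have := sq_nonneg (Real.sin (x 0)); nlinarith)
      (by have := Real.sin_sq_le_one (x 0); nlinarith) _))
    (fun s => BC.of_same fun y y' h => by
      simp only [Fin.cons_zero, Fin.tail_cons]
      rw [Gm_same f _ h, Gm_same f _ h])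
    hpi (fun y => by simp) (fun y => by simp)
  rw [← hB, ← hC]
  have hpd : ∀ y, pd (fun y => nv (ε⁻¹ • (Gm f (Fin.cons Real.pi y) - Gm f (Fin.cons 0 y)))) 2 y
      = 0 := by
    intro y
    have hsm : ContDiff ℝ (⊤ : ℕ∞)
        fun y : Fin 3 → ℝ => ε⁻¹ • (Gm f (Fin.cons Real.pi y) - Gm f (Fin.cons 0 y)) := by
      have hg : ∀ t : ℝ, ContDiff ℝ (⊤ : ℕ∞) fun y : Fin 3 → ℝ => Gm f (Fin.cons t y) := fun t =>
        (Gm_smooth hf).comp (cons_contDiff.comp (contDiff_const.prodMk contDiff_id))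
      exact ((hg _).sub (hg _)).const_smul ε⁻¹
    have hsm2 := nv_smooth hsm fun y => smul_ne_zero (inv_ne_zero he0.ne')
      (Gm_ne hinj Real.pi_pos le_rfl y)
    refine fderiv_const_line ((hsm2.differentiable (by simp)) y) fun r => ?_
    simp only [Gm_cons, pp_shift, Real.sin_pi, Real.sin_zero, zero_smul]
  unfold deg
  simp only [hpd]
  simp [Pf]

end LagSphere

/-- There is no Lagrangian embedding of the 2-sphere into `ℝ⁴`: no smooth embedding
`f : S² → ℝ² × ℝ²` (a smooth topological embedding which is an immersion) satisfies
`ω(d_pf(v), d_pf(w)) = 0` for every `p ∈ S²` and all tangent vectors `v, w`. -/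
theorem no_lagrangian_embedding_sphere_two :
    ¬ ∃ f : sphere (0 : EuclideanSpace ℝ (Fin 3)) 1 → (Fin 2 → ℝ) × (Fin 2 → ℝ),
      ContMDiff (𝓡 2) 𝓘(ℝ, (Fin 2 → ℝ) × (Fin 2 → ℝ)) (⊤ : ℕ∞) f ∧
      Topology.IsEmbedding f ∧
      (∀ p : sphere (0 : EuclideanSpace ℝ (Fin 3)) 1,
        Function.Injective (mfderiv (𝓡 2) 𝓘(ℝ, (Fin 2 → ℝ) × (Fin 2 → ℝ)) f p)) ∧
      (∀ p : sphere (0 : EuclideanSpace ℝ (Fin 3)) 1,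
        ∀ v w : TangentSpace (𝓡 2) p,
          stdSymplecticForm2 (mfderiv (𝓡 2) 𝓘(ℝ, (Fin 2 → ℝ) × (Fin 2 → ℝ)) f p v)
            (mfderiv (𝓡 2) 𝓘(ℝ, (Fin 2 → ℝ) × (Fin 2 → ℝ)) f p w) = 0) := by
  rintro ⟨f, hf, hemb, himm, hlag⟩
  exact LagSphere.deg_A_ne hf himm hlag (LagSphere.deg_A_eq hf hemb.injective himm)
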